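/- arXiv:2603.26140 — 4 statements merged into one kernel-verified Lean document; each statement's English description precedes it below -/
import Mathlib

section
/- Let H be a finite simple graph on a vertex set V of even size n ≥ 2, and let G be a 3-regular finite simple graph on a vertex set V' of size 2n with V ⊆ V'; set U = V' \ V. Let c1 be a real constant with 0 < c1 < 1/6, and assume that for every subset S ⊆ V with |S| ≤ n/2, the conductance of the cut S ∪ U in G satisfies φ_G(S ∪ U) ≤ c1·(|δ_H(S)| + n)/n. Let B be an integer with 0 ≤ B ≤ 2n and set φ0 = 1 − c1·(B + n)/n. If H admits a bisection S with width |δ_H(S)| ≤ B, then φ(G) ≤ c1·(B + n)/n = 1 − φ0, and moreover φ0 > 1/2, so that φ(G) < φ0. -/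
open Finset

/-- Number of edges of `G` with exactly one endpoint in `S` (counted via ordered
pairs `(u, v)` with `u ∈ S`, `v ∉ S`, `u ~ v`; each crossing edge is counted once). -/
def cutEdges {W : Type*} [Fintype W] [DecidableEq W] (G : SimpleGraph W)
    [DecidableRel G.Adj] (S : Finset W) : ℕ :=
  (Finset.univ.filter (fun p : W × W => p.1 ∈ S ∧ p.2 ∉ S ∧ G.Adj p.1 p.2)).card

/-- Volume of a vertex subset: sum of degrees. -/
def vol {W : Type*} [Fintype W] [DecidableEq W] (G : SimpleGraph W)
    [DecidableRel G.Adj] (S : Finset W) : ℕ :=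
  ∑ v ∈ S, G.degree v

/-- Conductance of a cut `S`. -/
noncomputable def conductance {W : Type*} [Fintype W] [DecidableEq W] (G : SimpleGraph W)
    [DecidableRel G.Adj] (S : Finset W) : ℝ :=
  (cutEdges G S : ℝ) / (min (vol G S) (vol G Sᶜ) : ℕ)

/-- Conductance of a graph. -/
noncomputable def graphConductance {W : Type*} [Fintype W] [DecidableEq W] (G : SimpleGraph W)
    [DecidableRel G.Adj] : ℝ :=
  sInf {x : ℝ | ∃ S : Finset W, 0 < vol G S ∧ 2 * vol G S ≤ vol G Finset.univ ∧
    x = conductance G S}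

/-- Normalized propagation matrix of a `d`-regular graph: `(1/d) • A`. -/
noncomputable def propMatrix {W : Type*} [Fintype W] [DecidableEq W] (G : SimpleGraph W)
    [DecidableRel G.Adj] (d : ℕ) : Matrix W W ℝ :=
  ((d : ℝ))⁻¹ • G.adjMatrix ℝ

/-- Second largest eigenvalue (with multiplicity) of a matrix: second entry of the
list of roots of the characteristic polynomial sorted in decreasing order. -/
noncomputable def mu2 {W : Type*} [Fintype W] [DecidableEq W] (A : Matrix W W ℝ) : ℝ :=
  ((A.charpoly.roots.sort (· ≤ ·)).reverse).getD 1 0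

/-- Smallest eigenvalue of a matrix. -/
noncomputable def muMin {W : Type*} [Fintype W] [DecidableEq W] (A : Matrix W W ℝ) : ℝ :=
  (A.charpoly.roots.sort (· ≤ ·)).getD 0 0

/-- Second smallest eigenvalue of a matrix. -/
noncomputable def lambda2 {W : Type*} [Fintype W] [DecidableEq W] (A : Matrix W W ℝ) : ℝ :=
  (A.charpoly.roots.sort (· ≤ ·)).getD 1 0

/-- Dirichlet energy of a feature matrix `X` on `G`. -/
noncomputable def dirichletEnergy {W : Type*} [Fintype W] [DecidableEq W] (G : SimpleGraph W)
    [DecidableRel G.Adj] {k : ℕ} (X : Matrix W (Fin k) ℝ) : ℝ :=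
  ∑ e ∈ G.edgeFinset, Sym2.lift ⟨fun u v => ∑ i, (X u i - X v i) ^ 2,
    fun u v => Finset.sum_congr rfl fun i _ => by ring⟩ e

/-- If `H` admits a bisection of width at most `B`, then the
conductance of `G` is at most `c1 * (B + n) / n = 1 - φ0`, and `φ0 > 1/2`, so
`φ(G) < φ0`. -/
theorem stmt0 {W : Type*} [Fintype W] [DecidableEq W]
    (H G : SimpleGraph W) [DecidableRel H.Adj] [DecidableRel G.Adj]
    (n : ℕ) (hn : 2 ≤ n) (hneven : Even n)
    (V : Finset W) (hV : V.card = n) (hW : Fintype.card W = 2 * n)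
    (hHV : ∀ u v : W, H.Adj u v → u ∈ V ∧ v ∈ V)
    (hreg : G.IsRegularOfDegree 3)
    (c1 : ℝ) (hc1pos : 0 < c1) (hc1 : c1 < 1 / 6)
    (hcut : ∀ S : Finset W, S ⊆ V → 2 * S.card ≤ n →
      conductance G (S ∪ Vᶜ) ≤ c1 * ((cutEdges H S : ℝ) + n) / n)
    (B : ℕ) (hB : B ≤ 2 * n)
    (φ0 : ℝ) (hφ0 : φ0 = 1 - c1 * ((B : ℝ) + n) / n)
    (S : Finset W) (hSV : S ⊆ V) (hSbis : 2 * S.card = n)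
    (hSwidth : cutEdges H S ≤ B) :
    graphConductance G ≤ c1 * ((B : ℝ) + n) / n ∧
      c1 * ((B : ℝ) + n) / n = 1 - φ0 ∧
      1 / 2 < φ0 ∧
      graphConductance G < φ0 := by
  have hn0 : (0 : ℝ) < n := by
    have : 0 < n := by omega
    exact_mod_cast this
  have hvol : ∀ T : Finset W, vol G T = T.card * 3 := by
    intro T
    unfold vol
    rw [Finset.sum_congr rfl (fun v _ => hreg v)]
    simp
  have hTcard : (S ∪ Vᶜ)ᶜ.card * 2 = n := by
    have h1 : (S ∪ Vᶜ).card = S.card + Vᶜ.card := by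
      apply Finset.card_union_of_disjoint
      rw [Finset.disjoint_left]
      intro a ha hb
      exact (Finset.mem_compl.mp hb) (hSV ha)
    rw [Finset.card_compl, h1, Finset.card_compl, hV, hW]
    omega
  have hsymm : conductance G (S ∪ Vᶜ)ᶜ = conductance G (S ∪ Vᶜ) := by
    have hc : cutEdges G (S ∪ Vᶜ)ᶜ = cutEdges G (S ∪ Vᶜ) := by
      unfold cutEdges
      apply Finset.card_bij (fun p _ => (p.2, p.1))
      · intro p hp
        rw [Finset.mem_filter] at hp ⊢
        obtain ⟨_, h1, h2, h3⟩ := hp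
        exact ⟨Finset.mem_univ _, by_contra fun h => h2 (Finset.mem_compl.mpr h),
          Finset.mem_compl.mp h1, h3.symm⟩
      · rintro ⟨a, b⟩ _ ⟨c, d⟩ _ h
        simp only [Prod.mk.injEq] at h ⊢
        exact ⟨h.2, h.1⟩
      · rintro ⟨a, b⟩ hp
        rw [Finset.mem_filter] at hp
        obtain ⟨_, h1, h2, h3⟩ := hp
        refine ⟨(b, a), ?_, rfl⟩
        rw [Finset.mem_filter]
        exact ⟨Finset.mem_univ _, Finset.mem_compl.mpr h2,
          fun h => (Finset.mem_compl.mp h) h1, h3.symm⟩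
    unfold conductance
    rw [hc, compl_compl, min_comm]
  have hle : graphConductance G ≤ c1 * ((B : ℝ) + n) / n := by
    have h1 : graphConductance G ≤ conductance G (S ∪ Vᶜ)ᶜ := by
      unfold graphConductance
      apply csInf_le
      · refine ⟨0, ?_⟩
        rintro x ⟨T, _, _, rfl⟩
        unfold conductance
        positivity
      · refine ⟨_, ?_, ?_, rfl⟩
        · rw [hvol]; omega
        · rw [hvol, hvol, Finset.card_univ, hW]; omega
    have h2 := hcut S hSV hSbis.le
    have h3 : (cutEdges H S : ℝ) ≤ B := by exact_mod_cast hSwidth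
    rw [hsymm] at h1
    refine h1.trans (h2.trans ?_)
    gcongr
  have hlt : c1 * ((B : ℝ) + n) / n < 1 / 2 := by
    have hB' : (B : ℝ) ≤ 2 * n := by exact_mod_cast hB
    rw [div_lt_iff₀ hn0]
    nlinarith
  refine ⟨hle, by linarith, by linarith, by linarith⟩
end

section
/- Let H be a finite simple graph on a vertex set V of even size n ≥ 2, and let G be a 3-regular finite simple graph on a vertex set V' of size 2n with V ⊆ V'; set U = V' \ V. Let c1 > 0 be a real constant and assume that for every subset S ⊆ V with |S| ≤ n/2, the conductance of the cut S ∪ U in G satisfies φ_G(S ∪ U) ≤ c1·(|δ_H(S)| + n)/n. Let B ≥ 0 be an integer, let ε' > 0 be real, and set τ = 1 − 2c1·(B + n)/n − ε'. If H admits a bisection of width at most B, then λ2(𝓛_G) ≤ 2c1·(B + n)/n, hence μ2(P_G) ≥ 1 − 2c1·(B + n)/n > τ. -/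
open Finset

theorem getD_one_of_countP (p : ℝ → Prop) [DecidablePred p] (r : ℝ → ℝ → Prop)
    (hr : ∀ a b, r a b → p b → p a) (l : List ℝ) (hl : l.Pairwise r)
    (h : 2 ≤ l.countP (fun x => decide (p x))) : p (l.getD 1 0) := by
  match l, hl, h with
  | [], _, h => simp at h
  | [a], _, h =>
    have := List.countP_le_length (p := fun x => decide (p x)) (l := [a])
    simp only [List.length_singleton] at this
    omega
  | a :: b :: t, hl, h =>
    by_contra hb
    replace hb : ¬ p b := by simpa using hb
    have h0 : t.countP (fun x => decide (p x)) = 0 := by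
      rw [List.countP_eq_zero]
      intro c hc
      have hbc := (List.pairwise_cons.1 (List.pairwise_cons.1 hl).2).1 c hc
      simpa using fun hpc => hb (hr _ _ hbc hpc)
    rw [List.countP_cons, List.countP_cons, h0] at h
    simp only [hb] at h
    split_ifs at h <;> simp_all

theorem quad_expand {W : Type*} [Fintype W] [DecidableEq W] (M : Matrix W W ℝ)
    (hM : M.IsHermitian) (z : W → ℝ) :
    dotProduct z (M.mulVec z) = ∑ i, hM.eigenvalues i *
      (((hM.eigenvectorUnitary : Matrix W W ℝ).transpose.mulVec z) i) ^ 2 ∧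
    dotProduct z z = ∑ i,
      (((hM.eigenvectorUnitary : Matrix W W ℝ).transpose.mulVec z) i) ^ 2 := by
  set U := (hM.eigenvectorUnitary : Matrix W W ℝ) with hU
  have h1 : U * U.transpose = 1 := by
    have := Matrix.mem_unitaryGroup_iff.1 hM.eigenvectorUnitary.2
    simpa [Matrix.star_eq_conjTranspose, Matrix.conjTranspose_eq_transpose_of_trivial] using this
  have h2 : M = U * Matrix.diagonal hM.eigenvalues * U.transpose := by
    have := hM.spectral_theorem
    rw [Unitary.conjStarAlgAut_apply] at this
    simpa [Matrix.star_eq_conjTranspose, Matrix.conjTranspose_eq_transpose_of_trivial,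
      Function.comp_def] using this
  have key : ∀ w : W → ℝ, dotProduct z (U.mulVec w) = dotProduct (U.transpose.mulVec z) w := by
    intro w
    rw [Matrix.dotProduct_mulVec, Matrix.mulVec_transpose]
  constructor
  · have : M.mulVec z = U.mulVec ((Matrix.diagonal hM.eigenvalues).mulVec (U.transpose.mulVec z)) := by
      conv_lhs => rw [h2]
      simp [Matrix.mulVec_mulVec, Matrix.mul_assoc]
    rw [this, key]
    simp only [dotProduct, Matrix.mulVec_diagonal]
    refine Finset.sum_congr rfl fun i _ => by ring
  · have : z = U.mulVec (U.transpose.mulVec z) := by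
      rw [Matrix.mulVec_mulVec, h1, Matrix.one_mulVec]
    have h3 := key (U.transpose.mulVec z)
    rw [← this] at h3
    rw [h3]
    simp only [dotProduct]
    refine Finset.sum_congr rfl fun i _ => by ring

theorem two_eigenvalues {W : Type*} [Fintype W] [DecidableEq W] [Nonempty W] (M : Matrix W W ℝ)
    (hM : M.IsHermitian) (x y : W → ℝ) (s θ : ℝ)
    (hxy : ∀ a b : ℝ, a • x + b • y = 0 → a = 0 ∧ b = 0)
    (hq : ∀ a b : ℝ, s * dotProduct (a • x + b • y) (M.mulVec (a • x + b • y)) ≤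
      s * θ * dotProduct (a • x + b • y) (a • x + b • y)) :
    ∃ i j, i ≠ j ∧ s * hM.eigenvalues i ≤ s * θ ∧ s * hM.eigenvalues j ≤ s * θ := by
  by_contra hcon
  have hi0 : ∃ i0, ∀ i, i ≠ i0 → s * θ < s * hM.eigenvalues i := by
    by_cases h : ∃ i0, s * hM.eigenvalues i0 ≤ s * θ
    · obtain ⟨i0, h0⟩ := h
      refine ⟨i0, fun i hi => ?_⟩
      by_contra hlt
      exact hcon ⟨i, i0, hi, not_lt.1 hlt, h0⟩
    · push Not at h
      exact ⟨Classical.arbitrary W, fun i _ => h i⟩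
  obtain ⟨i0, hi0⟩ := hi0
  set C := (hM.eigenvectorUnitary : Matrix W W ℝ).transpose with hC
  have hab : ∃ a b : ℝ, ¬ (a = 0 ∧ b = 0) ∧ a * (C.mulVec x) i0 + b * (C.mulVec y) i0 = 0 := by
    by_cases h : (C.mulVec x) i0 = 0
    · exact ⟨1, 0, by simp, by simp [h]⟩
    · exact ⟨-(C.mulVec y) i0, (C.mulVec x) i0, by simp [h], by ring⟩
  obtain ⟨a, b, hne, h0⟩ := hab
  have hz : a • x + b • y ≠ 0 := fun h => hne (hxy a b h)
  have hz0 : (C.mulVec (a • x + b • y)) i0 = 0 := by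
    simpa [Matrix.mulVec_add, Matrix.mulVec_smul] using h0
  have hqq := hq a b
  set z := a • x + b • y with hzdef
  obtain ⟨e1, e2⟩ := quad_expand M hM z
  rw [← hC] at e1 e2
  have hpos : 0 < dotProduct z z := by
    obtain ⟨w, hw⟩ := Function.ne_iff.1 hz
    refine Finset.sum_pos' (fun i _ => mul_self_nonneg _) ⟨w, Finset.mem_univ _, ?_⟩
    exact mul_self_pos.2 hw
  rw [e1, e2, Finset.mul_sum, Finset.mul_sum] at hqq
  have hterm : ∀ i, s * θ * (C.mulVec z) i ^ 2 ≤ s * (hM.eigenvalues i * (C.mulVec z) i ^ 2) := by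
    intro i
    by_cases h : i = i0
    · subst h; simp [hz0]
    · have := mul_le_mul_of_nonneg_right (hi0 i h).le (sq_nonneg ((C.mulVec z) i))
      linarith
  have hex : ∃ i, (C.mulVec z) i ≠ 0 := by
    by_contra hall
    push Not at hall
    rw [e2] at hpos
    simp [hall] at hpos
  obtain ⟨i, hi⟩ := hex
  have hii : i ≠ i0 := fun h => hi (h ▸ hz0)
  have : s * θ * (C.mulVec z) i ^ 2 < s * (hM.eigenvalues i * (C.mulVec z) i ^ 2) := by
    have := mul_lt_mul_of_pos_right (hi0 i hii) (pow_pos (abs_pos.2 hi) 2)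
    rw [sq_abs] at this
    linarith
  exact absurd hqq (not_le.2 (Finset.sum_lt_sum (fun i _ => hterm i) ⟨i, Finset.mem_univ _, this⟩))

theorem countP_roots {W : Type*} [Fintype W] [DecidableEq W] (M : Matrix W W ℝ)
    (hM : M.IsHermitian) (p : ℝ → Prop) [DecidablePred p]
    (h : ∃ i j, i ≠ j ∧ p (hM.eigenvalues i) ∧ p (hM.eigenvalues j)) :
    2 ≤ (M.charpoly.roots.sort (· ≤ ·)).countP (fun x => decide (p x)) := by
  obtain ⟨i, j, hij, hi, hj⟩ := h
  rw [← Multiset.coe_countP, Multiset.sort_eq, hM.roots_charpoly_eq_eigenvalues,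
    Multiset.countP_map]
  have : ({i, j} : Finset W) ⊆ Finset.univ.filter (fun a => p (hM.eigenvalues a)) := by
    intro k hk
    simp only [Finset.mem_insert, Finset.mem_singleton] at hk
    rcases hk with rfl | rfl <;> simp [hi, hj]
  have := Finset.card_le_card this
  rw [Finset.card_pair hij] at this
  simpa [Finset.card, Finset.filter] using this

theorem lambda2_le {W : Type*} [Fintype W] [DecidableEq W] (M : Matrix W W ℝ)
    (hM : M.IsHermitian) (θ : ℝ)
    (h : ∃ i j, i ≠ j ∧ hM.eigenvalues i ≤ θ ∧ hM.eigenvalues j ≤ θ) : lambda2 M ≤ θ := by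
  classical
  exact getD_one_of_countP (fun x => x ≤ θ) (· ≤ ·) (fun a b hab hb => le_trans hab hb) _
    (Multiset.pairwise_sort _ _) (countP_roots M hM (fun x => x ≤ θ) h)

theorem le_mu2 {W : Type*} [Fintype W] [DecidableEq W] (M : Matrix W W ℝ)
    (hM : M.IsHermitian) (θ : ℝ)
    (h : ∃ i j, i ≠ j ∧ θ ≤ hM.eigenvalues i ∧ θ ≤ hM.eigenvalues j) : θ ≤ mu2 M := by
  classical
  refine getD_one_of_countP (fun x => θ ≤ x) (· ≥ ·) (fun a b hab hb => le_trans hb hab) _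
    ?_ ?_
  · rw [List.pairwise_reverse]
    exact Multiset.pairwise_sort _ _
  · rw [List.countP_reverse]
    exact countP_roots M hM (fun x => θ ≤ x) h

theorem prop_herm {W : Type*} [Fintype W] [DecidableEq W] (G : SimpleGraph W)
    [DecidableRel G.Adj] : (propMatrix G 3).IsHermitian := by
  ext i j
  simp [propMatrix, SimpleGraph.adjMatrix_apply, G.adj_comm]

theorem prop_quad {W : Type*} [Fintype W] [DecidableEq W] (G : SimpleGraph W)
    [DecidableRel G.Adj] (hreg : G.IsRegularOfDegree 3) (T : Finset W) (a b : ℝ) (z : W → ℝ)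
    (hz : ∀ w, z w = a + b * (if w ∈ T then 1 else 0)) :
    dotProduct z ((propMatrix G 3).mulVec z) = dotProduct z z - b ^ 2 * (cutEdges G T : ℝ) / 3 := by
  set A : W → W → ℝ := fun u v => if G.Adj u v then 1 else 0 with hA
  set t : W → ℝ := fun w => if w ∈ T then 1 else 0 with ht
  have hcut : (cutEdges G T : ℝ) = ∑ u, ∑ v, A u v * (t u * (1 - t v)) := by
    rw [cutEdges, Finset.card_filter, ← Finset.univ_product_univ, Finset.sum_product]
    push_cast
    refine Finset.sum_congr rfl fun u _ => Finset.sum_congr rfl fun v _ => ?_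
    by_cases h1 : u ∈ T <;> by_cases h2 : v ∈ T <;> by_cases h3 : G.Adj u v <;>
      simp [hA, ht, h1, h2, h3]
  have hsymm : ∀ u v, A u v = A v u := fun u v => by simp [hA, G.adj_comm]
  have hcut' : (cutEdges G T : ℝ) = ∑ u, ∑ v, A u v * (t v * (1 - t u)) := by
    rw [hcut, Finset.sum_comm]
    refine Finset.sum_congr rfl fun u _ => Finset.sum_congr rfl fun v _ => ?_
    rw [hsymm]
  have hdeg : ∀ u, ∑ v, A u v = 3 := by
    intro u
    have := hreg u
    simp only [hA, Finset.sum_boole]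
    rw [← G.card_neighborFinset_eq_degree, G.neighborFinset_eq_filter] at this
    exact_mod_cast this
  have hzz : dotProduct z z * 3 = ∑ u, ∑ v, A u v * (z u) ^ 2 := by
    rw [dotProduct, Finset.sum_mul]
    refine Finset.sum_congr rfl fun u _ => ?_
    rw [← Finset.sum_mul, hdeg]; ring
  have hzz' : dotProduct z z * 3 = ∑ u, ∑ v, A u v * (z v) ^ 2 := by
    rw [hzz, Finset.sum_comm]
    refine Finset.sum_congr rfl fun u _ => Finset.sum_congr rfl fun v _ => ?_
    rw [hsymm]
  have hq : dotProduct z ((propMatrix G 3).mulVec z) * 3 = ∑ u, ∑ v, A u v * (z u * z v) := by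
    simp only [dotProduct, Matrix.mulVec, Finset.mul_sum, Finset.sum_mul]
    refine Finset.sum_congr rfl fun u _ => Finset.sum_congr rfl fun v _ => ?_
    simp only [propMatrix, Matrix.smul_apply, SimpleGraph.adjMatrix_apply, smul_eq_mul, hA]
    push_cast
    ring
  have hmain : 2 * (dotProduct z ((propMatrix G 3).mulVec z) * 3) =
      dotProduct z z * 3 + dotProduct z z * 3
        - b ^ 2 * ((cutEdges G T : ℝ) + (cutEdges G T : ℝ)) := by
    rw [hq]
    nth_rewrite 1 [hzz]
    nth_rewrite 1 [hzz']
    nth_rewrite 1 [hcut]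
    nth_rewrite 1 [hcut']
    simp only [← Finset.sum_add_distrib, Finset.mul_sum, ← Finset.sum_sub_distrib]
    refine Finset.sum_congr rfl fun u _ => Finset.sum_congr rfl fun v _ => ?_
    rw [hz u, hz v]
    by_cases h1 : u ∈ T <;> by_cases h2 : v ∈ T <;> simp [ht, h1, h2] <;> ring
  linarith

theorem norm_z {W : Type*} [Fintype W] [DecidableEq W] (T : Finset W) (a b : ℝ) (z : W → ℝ)
    (hz : ∀ w, z w = a + b * (if w ∈ T then 1 else 0)) :
    dotProduct z z = (a + b) ^ 2 * T.card + a ^ 2 * Tᶜ.card := by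
  rw [dotProduct, ← Finset.sum_add_sum_compl T]
  congr 1
  · rw [Finset.sum_congr rfl (g := fun _ => (a + b) ^ 2)
      (fun w hw => by rw [hz]; simp only [hw, if_true]; ring)]
    simp [mul_comm]
  · rw [Finset.sum_congr rfl (g := fun _ => a ^ 2)
      (fun w hw => by rw [hz]; simp only [Finset.mem_compl.1 hw, if_false]; ring)]
    simp [mul_comm]

/-- If `H` admits a bisection of width at most `B`, then
`λ₂(𝓛_G) ≤ 2c1(B+n)/n`, hence `μ₂(P_G) ≥ 1 - 2c1(B+n)/n > τ`. -/
theorem stmt3 {W : Type*} [Fintype W] [DecidableEq W]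
    (H G : SimpleGraph W) [DecidableRel H.Adj] [DecidableRel G.Adj]
    (n : ℕ) (hn : 2 ≤ n) (hneven : Even n)
    (V : Finset W) (hV : V.card = n) (hW : Fintype.card W = 2 * n)
    (hHV : ∀ u v : W, H.Adj u v → u ∈ V ∧ v ∈ V)
    (hreg : G.IsRegularOfDegree 3)
    (c1 : ℝ) (hc1pos : 0 < c1)
    (hcut : ∀ S : Finset W, S ⊆ V → 2 * S.card ≤ n →
      conductance G (S ∪ Vᶜ) ≤ c1 * ((cutEdges H S : ℝ) + n) / n)
    (B : ℕ) (ε' : ℝ) (hε' : 0 < ε')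
    (τ : ℝ) (hτ : τ = 1 - 2 * c1 * ((B : ℝ) + n) / n - ε')
    (hbis : ∃ S : Finset W, S ⊆ V ∧ 2 * S.card = n ∧ cutEdges H S ≤ B) :
    lambda2 (1 - propMatrix G 3) ≤ 2 * c1 * ((B : ℝ) + n) / n ∧
      1 - 2 * c1 * ((B : ℝ) + n) / n ≤ mu2 (propMatrix G 3) ∧
      τ < 1 - 2 * c1 * ((B : ℝ) + n) / n := by
  obtain ⟨S, hSV, hScard, hSB⟩ := hbis
  have hc := hcut S hSV hScard.le
  set T := S ∪ Vᶜ with hT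
  have hnpos : (0 : ℝ) < n := by exact_mod_cast (by omega : 0 < n)
  have hVc : Vᶜ.card = n := by rw [Finset.card_compl, hV, hW]; omega
  have hTc : T.card = S.card + n := by
    rw [hT, Finset.card_union_of_disjoint, hVc]
    exact Finset.disjoint_left.2 fun w hw hw' => (Finset.mem_compl.1 hw') (hSV hw)
  have hTcc : Tᶜ.card = S.card := by
    rw [Finset.card_compl, hTc, hW]; omega
  have hvol : ∀ R : Finset W, vol G R = 3 * R.card := by
    intro R
    rw [vol, Finset.sum_congr rfl (fun v _ => hreg v)]
    simp [mul_comm]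
  have hSr : (S.card : ℝ) = n / 2 := by
    have : (2 : ℝ) * S.card = n := by exact_mod_cast hScard
    linarith
  have hmin : min (vol G T) (vol G Tᶜ) = 3 * S.card := by
    rw [hvol, hvol, hTc, hTcc]; omega
  rw [conductance, hmin] at hc
  push_cast at hc
  rw [hSr] at hc
  set θ : ℝ := 2 * c1 * ((B : ℝ) + n) / n with hθ
  have hBr : (cutEdges H S : ℝ) ≤ B := by exact_mod_cast hSB
  have hc2 : c1 * ((cutEdges H S : ℝ) + n) / n ≤ θ / 2 := by
    have : θ / 2 = c1 * ((B : ℝ) + n) / n := by rw [hθ]; ring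
    rw [this]
    gcongr
  have hcutG : (cutEdges G T : ℝ) / 3 ≤ θ * (n / 4) := by
    have h := hc.trans hc2
    rw [div_le_iff₀ (by positivity)] at h
    linarith
  have hθ0 : 0 ≤ θ := by rw [hθ]; positivity
  have hWne : Nonempty W := Fintype.card_pos_iff.1 (by omega)
  set x : W → ℝ := fun _ => 1 with hx
  set y : W → ℝ := fun w => if w ∈ T then 1 else 0 with hy
  have hz : ∀ a b : ℝ, ∀ w, (a • x + b • y) w = a + b * (if w ∈ T then 1 else 0) := by
    intro a b w; simp [hx, hy]
  have hindep : ∀ a b : ℝ, a • x + b • y = 0 → a = 0 ∧ b = 0 := by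
    intro a b hab
    obtain ⟨u, hu⟩ := Finset.card_pos.1 (by omega : 0 < T.card)
    obtain ⟨v, hv⟩ := Finset.card_pos.1 (by omega : 0 < Tᶜ.card)
    have h1 := hz a b u
    have h2 := hz a b v
    rw [hab] at h1 h2
    simp only [hu, Finset.mem_compl.1 hv, if_true, if_false, Pi.zero_apply] at h1 h2
    constructor <;> linarith
  have hR : ∀ a b : ℝ, b ^ 2 * (cutEdges G T : ℝ) / 3 ≤
      θ * dotProduct (a • x + b • y) (a • x + b • y) := by
    intro a b
    rw [norm_z T a b _ (hz a b), hTc, hTcc]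
    push_cast
    rw [hSr]
    have h1 : b ^ 2 * ((cutEdges G T : ℝ) / 3) ≤ b ^ 2 * (θ * (n / 4)) :=
      mul_le_mul_of_nonneg_left hcutG (sq_nonneg b)
    have h2 : b ^ 2 * (n / 4) ≤ (a + b) ^ 2 * ((n : ℝ) / 2 + n) + a ^ 2 * (n / 2) := by
      nlinarith [mul_nonneg hnpos.le (sq_nonneg (4 * a + 3 * b)), mul_nonneg hnpos.le (sq_nonneg b)]
    have h3 := mul_le_mul_of_nonneg_left h2 hθ0
    linarith
  have hP := prop_herm G
  have hL : (1 - propMatrix G 3).IsHermitian := Matrix.isHermitian_one.sub hP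
  refine ⟨?_, ?_, ?_⟩
  · apply lambda2_le _ hL
    have := two_eigenvalues _ hL x y 1 θ hindep (by
      intro a b
      rw [Matrix.sub_mulVec, Matrix.one_mulVec, dotProduct_sub,
        prop_quad G hreg T a b _ (hz a b)]
      have := hR a b
      linarith)
    simpa using this
  · apply le_mu2 _ hP
    have := two_eigenvalues _ hP x y (-1) (1 - θ) hindep (by
      intro a b
      rw [prop_quad G hreg T a b _ (hz a b)]
      have := hR a b
      linarith)
    obtain ⟨i, j, hij, h1, h2⟩ := this
    exact ⟨i, j, hij, by linarith, by linarith⟩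
  · rw [hτ]; linarith
end

section
/- Let H be a finite simple graph on a vertex set V of even size n ≥ 2, and let G be a 3-regular finite simple graph on a vertex set V' of size 2n with V ⊆ V'. Let c1, c2, c3 be positive real constants with 2c2·√(3c1) < 1/2 and c3 < 1, let B be an integer with B ≥ 2n, let ε' be a real number with 0 < ε' ≤ c1·B/n, and set τ = 1 − 2c1·(B + n)/n − ε'. Assume that for every subset X ⊆ V' with 0 < vol(X) ≤ vol(V')/2 and φ_G(X) < 2·√(3c1·B/n), there exists S ⊆ V with |δ_H(S)| ≤ 2c2·√(3c1·B·n) together with a bisection S' of H satisfying |δ_H(S')| ≤ c3·|δ_H(S)|. If every bisection of H has width strictly greater than B, then μ2(P_G) ≤ τ. -/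
open Finset

lemma cut_sum {W : Type*} [Fintype W] [DecidableEq W] (G : SimpleGraph W)
    [DecidableRel G.Adj] (S : Finset W) :
    (cutEdges G S : ℝ) = ∑ u, ∑ v, (if u ∈ S ∧ v ∉ S ∧ G.Adj u v then (1:ℝ) else 0) := by
  rw [cutEdges, ← Fintype.sum_prod_type', Finset.sum_boole]

lemma cut_sum2 {W : Type*} [Fintype W] [DecidableEq W] (G : SimpleGraph W)
    [DecidableRel G.Adj] (S : Finset W) :
    2 * (cutEdges G S : ℝ) = ∑ u, ∑ v, (if G.Adj u v then
      |(if u ∈ S then (1:ℝ) else 0) - (if v ∈ S then (1:ℝ) else 0)| else 0) := by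
  rw [two_mul]
  nth_rw 2 [cut_sum]
  rw [Finset.sum_comm, cut_sum, ← Finset.sum_add_distrib]
  refine Finset.sum_congr rfl fun u _ => ?_
  rw [← Finset.sum_add_distrib]
  refine Finset.sum_congr rfl fun v _ => ?_
  by_cases h : G.Adj u v
  · have h' := h.symm
    by_cases hu : u ∈ S <;> by_cases hv : v ∈ S <;> simp [h, h', hu, hv]
  · have h' : ¬ G.Adj v u := fun h' => h h'.symm
    simp [h, h']

lemma coarea {W : Type*} [Fintype W] [DecidableEq W] (G : SimpleGraph W)
    [DecidableRel G.Adj] (k : ℝ)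
    (hk : ∀ T : Finset W, T.Nonempty → 2 * T.card ≤ Fintype.card W → k * T.card ≤ cutEdges G T) :
    ∀ (m : ℕ) (F : W → ℝ), (∀ u, 0 ≤ F u) → (univ.filter (fun u => F u ≠ 0)).card = m →
      2 * m ≤ Fintype.card W →
      2 * k * ∑ u, F u ≤ ∑ u, ∑ v, (if G.Adj u v then |F u - F v| else 0) := by
  intro m
  induction m using Nat.strong_induction_on with
  | _ m ih =>
  intro F hF hm hmN
  set T := univ.filter (fun u => F u ≠ 0) with hT
  rcases T.eq_empty_or_nonempty with he | hne
  · have h0 : ∀ u, F u = 0 := by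
      intro u
      by_contra h
      have : u ∈ T := by simp [hT, h]
      simp [he] at this
    simp [h0]
  obtain ⟨w, hwT, hw⟩ := T.exists_min_image F hne
  set F' : W → ℝ := fun u => F u - F w * (if u ∈ T then 1 else 0) with hF'
  have hout : ∀ u, u ∉ T → F u = 0 := by
    intro u hu
    by_contra h
    exact hu (by simp [hT, h])
  have hwpos := hF w
  have h1 : ∀ u, 0 ≤ F' u := by
    intro u
    by_cases hu : u ∈ T
    · have := hw u hu
      simp [hF', hu, this]
    · simp [hF', hu, hF u]
  have hsub : univ.filter (fun u => F' u ≠ 0) ⊂ T := by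
    rw [Finset.ssubset_iff_of_subset]
    · exact ⟨w, hwT, by simp [hF', hwT]⟩
    · intro u hu
      by_contra h
      simp [hF', h, hout u h] at hu
  have hlt := Finset.card_lt_card hsub
  have := ih _ (by omega) F' h1 rfl (by omega)
  have hcut := hk T hne (by omega)
  have hs : ∑ u, F u = ∑ u, F' u + F w * T.card := by
    simp [hF', Finset.sum_sub_distrib]
    ring
  have hE : ∑ u, ∑ v, (if G.Adj u v then |F u - F v| else 0)
      = ∑ u, ∑ v, (if G.Adj u v then |F' u - F' v| else 0) + F w * (2 * cutEdges G T) := by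
    rw [cut_sum2, Finset.mul_sum, ← Finset.sum_add_distrib]
    refine Finset.sum_congr rfl fun u _ => ?_
    rw [Finset.mul_sum, ← Finset.sum_add_distrib]
    refine Finset.sum_congr rfl fun v _ => ?_
    by_cases h : G.Adj u v
    · by_cases hu : u ∈ T <;> by_cases hv : v ∈ T
      · simp [h, hF', hu, hv]
      · have a := hw u hu
        simp only [h, hF', hu, hv, hout v hv, if_true, if_false]
        rw [abs_of_nonneg (by linarith [hF u]), abs_of_nonneg (by linarith)]
        norm_num
      · have a := hw v hv
        simp only [h, hF', hu, hv, hout u hu, if_true, if_false]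
        rw [abs_of_nonpos (by linarith [hF v]), abs_of_nonpos (by linarith)]
        norm_num
      · simp [h, hF', hu, hv]
    · simp [h]
  rw [hs, hE]
  have := mul_le_mul_of_nonneg_left hcut hwpos
  nlinarith

lemma reg_sum {W : Type*} [Fintype W] [DecidableEq W] (G : SimpleGraph W)
    [DecidableRel G.Adj] (hreg : G.IsRegularOfDegree 3) (g : W → ℝ) :
    ∑ u, ∑ v, (if G.Adj u v then g u else 0) = 3 * ∑ u, g u := by
  rw [Finset.mul_sum]
  refine Finset.sum_congr rfl fun u _ => ?_
  rw [← Finset.sum_filter, Finset.sum_const, ← G.neighborFinset_eq_filter, G.card_neighborFinset_eq_degree, hreg u]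
  simp

lemma reg_sum' {W : Type*} [Fintype W] [DecidableEq W] (G : SimpleGraph W)
    [DecidableRel G.Adj] (hreg : G.IsRegularOfDegree 3) (g : W → ℝ) :
    ∑ u, ∑ v, (if G.Adj u v then g v else 0) = 3 * ∑ u, g u := by
  rw [← reg_sum G hreg, Finset.sum_comm]
  simp_rw [G.adj_comm]

lemma cheeger_half {W : Type*} [Fintype W] [DecidableEq W] (G : SimpleGraph W)
    [DecidableRel G.Adj] (hreg : G.IsRegularOfDegree 3) (p : ℝ) (hp : 0 ≤ p)
    (hk : ∀ T : Finset W, T.Nonempty → 2 * T.card ≤ Fintype.card W →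
      3 * p * T.card ≤ cutEdges G T)
    (h : W → ℝ) (hs : 2 * (univ.filter (fun u => h u ≠ 0)).card ≤ Fintype.card W) :
    3 * p ^ 2 * ∑ u, h u ^ 2 ≤ ∑ u, ∑ v, (if G.Adj u v then (h u - h v) ^ 2 else 0) := by
  have h1 := coarea G (3 * p) hk _ (fun u => h u ^ 2) (fun u => sq_nonneg _) rfl
    (by simpa using hs)
  set Q := ∑ u, h u ^ 2 with hQ
  set E := ∑ u, ∑ v, (if G.Adj u v then (h u - h v) ^ 2 else 0) with hE
  have hQ0 : 0 ≤ Q := Finset.sum_nonneg fun u _ => sq_nonneg _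
  have hE0 : 0 ≤ E := Finset.sum_nonneg fun u _ => Finset.sum_nonneg fun v _ => by
    split_ifs <;> positivity
  have hplus : ∑ u, ∑ v, (if G.Adj u v then (h u + h v) ^ 2 else 0) ≤ 12 * Q := by
    have e1 := reg_sum G hreg (fun u => 2 * h u ^ 2)
    have e2 := reg_sum' G hreg (fun u => 2 * h u ^ 2)
    rw [← Finset.mul_sum] at e1 e2
    have : ∑ u, ∑ v, (if G.Adj u v then (h u + h v) ^ 2 else 0) ≤
      ∑ u, ∑ v, (if G.Adj u v then 2 * h u ^ 2 else 0) +
      ∑ u, ∑ v, (if G.Adj u v then 2 * h v ^ 2 else 0) := by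
      rw [← Finset.sum_add_distrib]
      refine Finset.sum_le_sum fun u _ => ?_
      rw [← Finset.sum_add_distrib]
      refine Finset.sum_le_sum fun v _ => ?_
      split_ifs
      · nlinarith [sq_nonneg (h u - h v)]
      · simp
    linarith
  have hcs : (∑ u, ∑ v, (if G.Adj u v then |h u ^ 2 - h v ^ 2| else 0)) ^ 2 ≤
      E * ∑ u, ∑ v, (if G.Adj u v then (h u + h v) ^ 2 else 0) := by
    have := Finset.sum_mul_sq_le_sq_mul_sq (univ : Finset (W × W))
      (fun q => if G.Adj q.1 q.2 then |h q.1 - h q.2| else 0)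
      (fun q => if G.Adj q.1 q.2 then |h q.1 + h q.2| else 0)
    simp only [Fintype.sum_prod_type] at this
    refine le_of_eq_of_le ?_ (this.trans_eq ?_)
    · congr 1
      refine Finset.sum_congr rfl fun u _ => Finset.sum_congr rfl fun v _ => ?_
      split_ifs
      · rw [← abs_mul]; congr 1; ring
      · simp
    · rw [hE]
      congr 1 <;>
      · refine Finset.sum_congr rfl fun u _ => Finset.sum_congr rfl fun v _ => ?_
        split_ifs <;> simp
  have h2 : (2 * (3 * p) * Q) ^ 2 ≤ E * (12 * Q) := by
    refine le_trans (pow_le_pow_left₀ (by positivity) h1 2) (hcs.trans ?_)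
    exact mul_le_mul_of_nonneg_left hplus hE0
  rcases hQ0.eq_or_lt with hz | hpos
  · rw [← hz]; simpa using hE0
  · have : 12 * Q * (3 * p ^ 2 * Q) ≤ 12 * Q * E := by nlinarith
    exact le_of_mul_le_mul_left this (by positivity)

lemma exists_median {W : Type*} [Fintype W] [DecidableEq W] [Nonempty W] (f : W → ℝ) :
    ∃ c : ℝ, 2 * (univ.filter (fun u => c < f u)).card ≤ Fintype.card W ∧
      2 * (univ.filter (fun u => f u < c)).card ≤ Fintype.card W := by
  obtain ⟨z, -, hz⟩ := (univ : Finset W).exists_max_image f univ_nonempty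
  have hne : (univ.filter (fun w => 2 * (univ.filter (fun u => f w < f u)).card
      ≤ Fintype.card W)).Nonempty := by
    refine ⟨z, ?_⟩
    have : univ.filter (fun u => f z < f u) = ∅ := by
      ext u; simpa using hz u (mem_univ u)
    simp [this]
  obtain ⟨w, hw, hmin⟩ := exists_min_image _ f hne
  refine ⟨f w, by simpa using hw, ?_⟩
  by_contra! hcon
  have hne2 : (univ.filter (fun u => f u < f w)).Nonempty := by
    rw [← Finset.card_pos]; omega
  obtain ⟨y, hy, hmax⟩ := exists_max_image _ f hne2
  have hy' : f y < f w := by simpa using hy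
  have h1 : Fintype.card W < 2 * (univ.filter (fun u => f y < f u)).card := by
    by_contra! h
    have := hmin y (by simpa using h)
    linarith
  have hd : Disjoint (univ.filter (fun u => f y < f u)) (univ.filter (fun u => f u < f w)) := by
    rw [Finset.disjoint_left]
    intro u hu hu'
    have := hmax u hu'
    simp at hu
    linarith
  have := Finset.card_union_of_disjoint hd
  have := Finset.card_le_univ (univ.filter (fun u => f y < f u) ∪ univ.filter (fun u => f u < f w))
  omega

lemma cheeger {W : Type*} [Fintype W] [DecidableEq W] [Nonempty W] (G : SimpleGraph W)
    [DecidableRel G.Adj] (hreg : G.IsRegularOfDegree 3) (p : ℝ) (hp : 0 ≤ p)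
    (hk : ∀ T : Finset W, T.Nonempty → 2 * T.card ≤ Fintype.card W →
      3 * p * T.card ≤ cutEdges G T)
    (f : W → ℝ) (hf : ∑ u, f u = 0) :
    3 * p ^ 2 * ∑ u, f u ^ 2 ≤ ∑ u, ∑ v, (if G.Adj u v then (f u - f v) ^ 2 else 0) := by
  obtain ⟨c, hc1, hc2⟩ := exists_median f
  have h1 := cheeger_half G hreg p hp hk (fun u => max (f u - c) 0) (by
    convert hc1 using 5 with u
    simp)
  have h2 := cheeger_half G hreg p hp hk (fun u => max (c - f u) 0) (by
    convert hc2 using 5 with u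
    simp)
  have h3 : ∑ u, f u ^ 2 ≤ ∑ u, (max (f u - c) 0) ^ 2 + ∑ u, (max (c - f u) 0) ^ 2 := by
    have e : ∀ u, (max (f u - c) 0) ^ 2 + (max (c - f u) 0) ^ 2 = f u ^ 2 - 2 * c * f u + c ^ 2 := by
      intro u
      rcases le_total (f u) c with h | h
      · rw [max_eq_right (by linarith), max_eq_left (by linarith)]; ring
      · rw [max_eq_left (by linarith), max_eq_right (by linarith)]; ring
    rw [← Finset.sum_add_distrib, Finset.sum_congr rfl fun u _ => e u, Finset.sum_add_distrib,
      Finset.sum_sub_distrib, ← Finset.mul_sum, hf]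
    have : 0 ≤ ∑ u : W, c ^ 2 := by positivity
    linarith
  have h4 : ∑ u, ∑ v, (if G.Adj u v then (max (f u - c) 0 - max (f v - c) 0) ^ 2 else 0) +
      ∑ u, ∑ v, (if G.Adj u v then (max (c - f u) 0 - max (c - f v) 0) ^ 2 else 0) ≤
      ∑ u, ∑ v, (if G.Adj u v then (f u - f v) ^ 2 else 0) := by
    rw [← Finset.sum_add_distrib]
    refine Finset.sum_le_sum fun u _ => ?_
    rw [← Finset.sum_add_distrib]
    refine Finset.sum_le_sum fun v _ => ?_
    split_ifs
    · rcases le_total (f u) c with h | h <;> rcases le_total (f v) c with h' | h'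
      · rw [max_eq_right (by linarith : f u - c ≤ 0), max_eq_right (by linarith : f v - c ≤ 0), max_eq_left (by linarith: 0 ≤ c - f u), max_eq_left (by linarith : 0 ≤ c - f v)]; nlinarith
      · rw [max_eq_right (by linarith : f u - c ≤ 0), max_eq_left (by linarith : 0 ≤ f v - c), max_eq_left (by linarith: 0 ≤ c - f u), max_eq_right (by linarith : c - f v ≤ 0)]; nlinarith [mul_nonneg (sub_nonneg.2 h) (sub_nonneg.2 h')]
      · rw [max_eq_left (by linarith : 0 ≤ f u - c), max_eq_right (by linarith : f v - c ≤ 0), max_eq_right (by linarith: c - f u ≤ 0), max_eq_left (by linarith : 0 ≤ c - f v)]; nlinarith [mul_nonneg (sub_nonneg.2 h) (sub_nonneg.2 h')]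
      · rw [max_eq_left (by linarith : 0 ≤ f u - c), max_eq_left (by linarith : 0 ≤ f v - c), max_eq_right (by linarith: c - f u ≤ 0), max_eq_right (by linarith : c - f v ≤ 0)]; nlinarith
    · simp
  have h5 := mul_le_mul_of_nonneg_left h3 (by positivity : 0 ≤ 3 * p ^ 2)
  linarith

lemma two_eigs {W : Type*} [Fintype W] [DecidableEq W] (A : Matrix W W ℝ) (hA : A.IsHermitian)
    (hcard : 2 ≤ Fintype.card W) (t : ℝ) (ht : t < mu2 A) :
    ∃ i j, i ≠ j ∧ t < hA.eigenvalues i ∧ t < hA.eigenvalues j := by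
  have hl : (A.charpoly.roots.sort (· ≤ ·)).reverse = List.ofFn hA.eigenvalues₀ := by
    refine List.Perm.eq_of_pairwise' (r := (· ≥ ·)) ?_ ?_ ?_
    · rw [List.pairwise_reverse]
      exact Multiset.pairwise_sort _ _
    · rw [List.pairwise_ofFn]
      exact fun i j hij => hA.eigenvalues₀_antitone hij.le
    · refine (List.reverse_perm _).trans ?_
      rw [← Multiset.coe_eq_coe, Multiset.sort_eq, hA.roots_charpoly_eq_eigenvalues₀,
        Fin.univ_val_map]
      rfl
  have h1 : t < hA.eigenvalues₀ ⟨1, by omega⟩ := by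
    rw [mu2, hl, List.getD_eq_getElem _ _ (by simp; omega)] at ht
    simpa using ht
  have h0 : t < hA.eigenvalues₀ ⟨0, by omega⟩ :=
    h1.trans_le (hA.eigenvalues₀_antitone (by simp))
  let e := Fintype.equivOfCardEq (Fintype.card_fin (Fintype.card W)) (α := Fin (Fintype.card W)) (β := W)
  refine ⟨e ⟨0, by omega⟩, e ⟨1, by omega⟩, by simp, ?_, ?_⟩
  · simpa [Matrix.IsHermitian.eigenvalues, e] using h0
  · simpa [Matrix.IsHermitian.eigenvalues, e] using h1

open Matrix in
lemma rayleigh_vec {W : Type*} [Fintype W] [DecidableEq W] (A : Matrix W W ℝ) (hA : A.IsHermitian)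
    (hcard : 2 ≤ Fintype.card W) (t : ℝ) (ht : t < mu2 A) :
    ∃ f : W → ℝ, ∑ u, f u = 0 ∧ t * ∑ u, f u ^ 2 < ∑ u, f u * (A *ᵥ f) u := by
  obtain ⟨i, j, hij, hi, hj⟩ := two_eigs A hA hcard t ht
  set x : W → ℝ := ⇑(hA.eigenvectorBasis i) with hx
  set y : W → ℝ := ⇑(hA.eigenvectorBasis j) with hy
  have hxx : ∑ u, x u * x u = 1 := by
    have := hA.eigenvectorBasis.inner_eq_one i
    rw [PiLp.inner_apply] at this
    exact this
  have hyy : ∑ u, y u * y u = 1 := by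
    have := hA.eigenvectorBasis.inner_eq_one j
    rw [PiLp.inner_apply] at this
    exact this
  have hxy : ∑ u, x u * y u = 0 := by
    have := hA.eigenvectorBasis.inner_eq_zero hij.symm
    simpa [PiLp.inner_apply] using this
  have hAx := hA.mulVec_eigenvectorBasis i
  have hAy := hA.mulVec_eigenvectorBasis j
  have key : ∀ a b : ℝ, a ^ 2 + b ^ 2 ≠ 0 → a * ∑ u, x u + b * ∑ u, y u = 0 →
      ∃ f : W → ℝ, ∑ u, f u = 0 ∧ t * ∑ u, f u ^ 2 < ∑ u, f u * (A *ᵥ f) u := by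
    intro a b hab h0
    refine ⟨a • x + b • y, ?_, ?_⟩
    · simpa [Finset.sum_add_distrib, ← Finset.mul_sum] using h0
    · have e1 : ∑ u, (a • x + b • y) u ^ 2 = a ^ 2 + b ^ 2 := by
        calc _ = a ^ 2 * ∑ u, x u * x u + 2 * a * b * ∑ u, x u * y u + b ^ 2 * ∑ u, y u * y u := by
              simp only [Finset.mul_sum, ← Finset.sum_add_distrib]
              refine Finset.sum_congr rfl fun u _ => ?_
              simp only [Pi.add_apply, Pi.smul_apply, smul_eq_mul]; ring
          _ = _ := by rw [hxx, hxy, hyy]; ring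
      have e2 : ∑ u, (a • x + b • y) u * (A *ᵥ (a • x + b • y)) u
          = a ^ 2 * hA.eigenvalues i + b ^ 2 * hA.eigenvalues j := by
        rw [mulVec_add, mulVec_smul, mulVec_smul, hAx, hAy]
        calc _ = a ^ 2 * hA.eigenvalues i * ∑ u, x u * x u
              + a * b * (hA.eigenvalues i + hA.eigenvalues j) * ∑ u, x u * y u
              + b ^ 2 * hA.eigenvalues j * ∑ u, y u * y u := by
              simp only [Finset.mul_sum, ← Finset.sum_add_distrib]
              refine Finset.sum_congr rfl fun u _ => ?_
              simp only [Pi.add_apply, Pi.smul_apply, smul_eq_mul, ← hx, ← hy]; ring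
          _ = _ := by rw [hxx, hxy, hyy]; ring
      rw [e1, e2]
      by_cases ha : a = 0
      · have hb : 0 < b ^ 2 := by
          have : b ≠ 0 := by rintro rfl; simp [ha] at hab
          positivity
        rw [ha]; nlinarith
      · have : 0 < a ^ 2 := by positivity
        nlinarith [sq_nonneg b]
  by_cases hz : ∑ u, x u = 0
  · exact key 1 0 (by norm_num) (by simp [hz])
  · refine key (∑ u, y u) (-∑ u, x u) ?_ (by ring)
    have : 0 < (∑ u, x u) ^ 2 := by positivity
    nlinarith [sq_nonneg (∑ u, y u)]

open Matrix in
lemma energy_eq {W : Type*} [Fintype W] [DecidableEq W] (G : SimpleGraph W)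
    [DecidableRel G.Adj] (hreg : G.IsRegularOfDegree 3) (f : W → ℝ) :
    ∑ u, ∑ v, (if G.Adj u v then (f u - f v) ^ 2 else 0)
      = 6 * ∑ u, f u ^ 2 - 6 * ∑ u, f u * (propMatrix G 3 *ᵥ f) u := by
  have e1 := reg_sum G hreg (fun u => f u ^ 2)
  have e2 := reg_sum' G hreg (fun u => f u ^ 2)
  have e3 : 6 * ∑ u, f u * (propMatrix G 3 *ᵥ f) u
      = ∑ u, ∑ v, (if G.Adj u v then 2 * (f u * f v) else 0) := by
    rw [Finset.mul_sum]
    refine Finset.sum_congr rfl fun u _ => ?_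
    simp only [propMatrix, mulVec, dotProduct, Matrix.smul_apply, SimpleGraph.adjMatrix_apply,
      Finset.mul_sum]
    refine Finset.sum_congr rfl fun v _ => ?_
    split_ifs
    · simp; ring
    · simp
  rw [e3]
  have : ∑ u, ∑ v, (if G.Adj u v then (f u - f v) ^ 2 else 0)
      = ∑ u, ∑ v, (if G.Adj u v then f u ^ 2 else 0)
      + ∑ u, ∑ v, (if G.Adj u v then f v ^ 2 else 0)
      - ∑ u, ∑ v, (if G.Adj u v then 2 * (f u * f v) else 0) := by
    simp only [← Finset.sum_add_distrib, ← Finset.sum_sub_distrib]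
    refine Finset.sum_congr rfl fun u _ => Finset.sum_congr rfl fun v _ => ?_
    split_ifs
    · ring
    · simp
  rw [this, e1, e2]; ring

/-- If every bisection of `H` has width strictly greater than `B`,
then `μ₂(P_G) ≤ τ`. -/
theorem stmt4 {W : Type*} [Fintype W] [DecidableEq W]
    (H G : SimpleGraph W) [DecidableRel H.Adj] [DecidableRel G.Adj]
    (n : ℕ) (hn : 2 ≤ n) (hneven : Even n)
    (V : Finset W) (hV : V.card = n) (hW : Fintype.card W = 2 * n)
    (hHV : ∀ u v : W, H.Adj u v → u ∈ V ∧ v ∈ V)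
    (hreg : G.IsRegularOfDegree 3)
    (c1 c2 c3 : ℝ) (hc1pos : 0 < c1) (hc2pos : 0 < c2) (hc3pos : 0 < c3)
    (hc1c2 : 2 * c2 * Real.sqrt (3 * c1) < 1 / 2) (hc3 : c3 < 1)
    (B : ℕ) (hB : 2 * n ≤ B)
    (ε' : ℝ) (hε'pos : 0 < ε') (hε' : ε' ≤ c1 * (B : ℝ) / n)
    (τ : ℝ) (hτ : τ = 1 - 2 * c1 * ((B : ℝ) + n) / n - ε')
    (hrec : ∀ X : Finset W, 0 < vol G X → 2 * vol G X ≤ vol G Finset.univ →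
      conductance G X < 2 * Real.sqrt (3 * c1 * (B : ℝ) / n) →
      ∃ S : Finset W, S ⊆ V ∧ (cutEdges H S : ℝ) ≤ 2 * c2 * Real.sqrt (3 * c1 * (B : ℝ) * n) ∧
        ∃ S' : Finset W, S' ⊆ V ∧ 2 * S'.card = n ∧
          (cutEdges H S' : ℝ) ≤ c3 * (cutEdges H S : ℝ))
    (hnobis : ∀ S' : Finset W, S' ⊆ V → 2 * S'.card = n → B < cutEdges H S') :
    mu2 (propMatrix G 3) ≤ τ := by
  by_contra! hcon
  have hn0 : (0:ℝ) < n := by exact_mod_cast (by omega : 0 < n)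
  have hBn : 2 * (n:ℝ) ≤ B := by exact_mod_cast hB
  have hB0 : (0:ℝ) < B := by linarith
  have : Nonempty W := Fintype.card_pos_iff.mp (by omega)
  have hvol : ∀ X : Finset W, vol G X = 3 * X.card := by
    intro X
    simp [vol, hreg.degree_eq, mul_comm]
  set p := 2 * Real.sqrt (3 * c1 * (B : ℝ) / n) with hp
  have hp0 : 0 ≤ p := by positivity
  have hp2 : p ^ 2 = 12 * (c1 * B / n) := by
    rw [hp, mul_pow, Real.sq_sqrt (by positivity)]; ring
  have hcond : ∀ X : Finset W, X.Nonempty → 2 * X.card ≤ Fintype.card W →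
      p ≤ conductance G X := by
    intro X hne hX
    by_contra! hlt
    have hpos := hne.card_pos
    obtain ⟨S, hSV, hS, S', hS'V, hS'c, hS'⟩ := hrec X (by rw [hvol]; omega)
      (by rw [hvol, hvol, Finset.card_univ]; omega) hlt
    have h1 : (B:ℝ) < cutEdges H S' := by exact_mod_cast hnobis S' hS'V hS'c
    have h2 : Real.sqrt (3 * c1 * (B : ℝ) * n) = Real.sqrt (3 * c1) * Real.sqrt (B * n) := by
      rw [← Real.sqrt_mul (by positivity), mul_assoc]
    have h3 : Real.sqrt ((B:ℝ) * n) ≤ B := by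
      rw [Real.sqrt_le_left hB0.le]
      nlinarith
    have h4 : (0:ℝ) ≤ cutEdges H S := by positivity
    have h5 := Real.sqrt_nonneg ((B:ℝ) * n)
    rw [h2] at hS
    have h6 : 2 * c2 * Real.sqrt (3 * c1) * Real.sqrt ((B:ℝ) * n) ≤ 1 / 2 * Real.sqrt ((B:ℝ) * n) :=
      mul_le_mul_of_nonneg_right hc1c2.le h5
    nlinarith
  have hk : ∀ T : Finset W, T.Nonempty → 2 * T.card ≤ Fintype.card W →
      3 * p * T.card ≤ cutEdges G T := by
    intro T hne hT
    have h1 := hcond T hne hT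
    have hpos := hne.card_pos
    have hc := Finset.card_compl T
    rw [conductance, min_eq_left (by rw [hvol, hvol]; omega), hvol,
      le_div_iff₀ (by exact_mod_cast (by omega : 0 < 3 * T.card))] at h1
    push_cast at h1
    linarith
  have hA : (propMatrix G 3).IsHermitian := by
    rw [propMatrix, Matrix.IsHermitian, Matrix.conjTranspose_smul,
      Matrix.conjTranspose_eq_transpose_of_trivial, SimpleGraph.transpose_adjMatrix]
    simp
  obtain ⟨f, hf0, hf⟩ := rayleigh_vec _ hA (by omega) τ hcon
  have hch := cheeger G hreg p hp0 hk f hf0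
  rw [energy_eq G hreg, hp2] at hch
  have hq : (0:ℝ) ≤ ∑ u, f u ^ 2 := Finset.sum_nonneg fun u _ => sq_nonneg _
  have hτ' : 1 - 6 * (c1 * B / n) ≤ τ := by
    have e1 : 2 * c1 * ((B : ℝ) + n) / n = 2 * (c1 * B / n) + 2 * c1 := by
      field_simp
    have e2 : 2 * c1 ≤ c1 * B / n := by
      rw [le_div_iff₀ hn0]; nlinarith
    rw [hτ, e1]; linarith
  have := mul_le_mul_of_nonneg_right hτ' hq
  nlinarith
end

section
/- Let G be a d-regular finite simple graph on n ≥ 2 vertices with d ≥ 1, let A be its adjacency matrix, and let P = (1/d)·A, with eigenvalues 1 = μ1 ≥ μ2 ≥ … ≥ μ_n ≥ −1. Assume |μ_n| ≤ μ2. For a feature matrix X ∈ ℝ^{n × k}, define the Dirichlet energy ℰ(X) = Σ_{{u,v} ∈ E(G)} ‖X_u − X_v‖², where X_u denotes the row of X indexed by vertex u. Then for every integer L ≥ 0, the features X^{(L)} = P^L · X obtained after L propagation steps satisfy ℰ(X^{(L)}) ≤ (μ2)^{2L} · ℰ(X). -/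
open Finset

theorem energy_eq_lap {W : Type*} [Fintype W] [DecidableEq W] (G : SimpleGraph W)
    [DecidableRel G.Adj] {k : ℕ} (X : Matrix W (Fin k) ℝ) :
    dirichletEnergy G X = ∑ i, (fun u => X u i) ⬝ᵥ (G.lapMatrix ℝ).mulVec (fun u => X u i) := by
  have h1 : ∀ i : Fin k, (fun u => X u i) ⬝ᵥ (G.lapMatrix ℝ).mulVec (fun u => X u i)
      = (∑ u : W, ∑ v : W, if G.Adj u v then (X u i - X v i) ^ 2 else 0) / 2 := by
    intro i
    rw [← Matrix.toLinearMap₂'_apply', SimpleGraph.lapMatrix_toLinearMap₂']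
  simp_rw [h1]
  rw [← Finset.sum_div, eq_div_iff (by norm_num)]
  set f : Sym2 W → ℝ := Sym2.lift ⟨fun u v => ∑ i, (X u i - X v i) ^ 2,
    fun u v => Finset.sum_congr rfl fun i _ => by ring⟩ with hf
  have h2 : dirichletEnergy G X = ∑ e ∈ G.edgeFinset, f e := rfl
  have h3 : ∑ a : G.Dart, f a.edge = (∑ e ∈ G.edgeFinset, f e) * 2 := by
    rw [← Finset.sum_fiberwise_of_maps_to (s := Finset.univ) (t := G.edgeFinset)
      (g := fun a : G.Dart => a.edge)
      (fun a _ => by rw [SimpleGraph.mem_edgeFinset]; exact a.edge_mem), Finset.sum_mul]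
    refine Finset.sum_congr rfl fun e he => ?_
    rw [Finset.sum_congr rfl (g := fun _ => f e)
      (fun a ha => by rw [(Finset.mem_filter.1 ha).2]), Finset.sum_const,
      G.dart_edge_fiber_card e (SimpleGraph.mem_edgeFinset.1 he)]
    rw [nsmul_eq_mul, mul_comm, Nat.cast_ofNat]
  have h4 : ∑ a : G.Dart, f a.edge
      = ∑ p ∈ Finset.univ.filter (fun p : W × W => G.Adj p.1 p.2), f s(p.1, p.2) := by
    refine Finset.sum_bij' (fun a _ => (a.fst, a.snd))
      (fun p h => ⟨p, (Finset.mem_filter.1 h).2⟩) ?_ ?_ ?_ ?_ ?_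
    · intro a _; simp
    · simp
    · simp
    · simp
    · intro a _; rfl
  rw [h2, ← h3, h4, Finset.sum_filter, Fintype.sum_prod_type]
  symm
  rw [Finset.sum_comm]
  refine Finset.sum_congr rfl fun u _ => ?_
  rw [Finset.sum_comm]
  refine Finset.sum_congr rfl fun v _ => ?_
  by_cases h : G.Adj u v <;> simp [h, hf]

theorem le_mu2_aux {W : Type*} [Fintype W] [DecidableEq W] (A : Matrix W W ℝ) (x y : ℝ)
    (hx : x ∈ A.charpoly.roots) (hy : y ∈ A.charpoly.roots) (hxy : x < y) : x ≤ mu2 A := by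
  unfold mu2
  have hs : (A.charpoly.roots.sort (· ≤ ·)).Pairwise (· ≤ ·) := Multiset.pairwise_sort _ _
  rw [← Multiset.mem_sort (· ≤ ·)] at hx hy
  generalize A.charpoly.roots.sort (· ≤ ·) = l at *
  obtain ⟨i, hi, rfl⟩ := List.mem_iff_getElem.1 hx
  obtain ⟨j, hj, rfl⟩ := List.mem_iff_getElem.1 hy
  have hij : i < j := by
    by_contra hc
    rcases (not_lt.1 hc).eq_or_lt with h | h
    · subst h; exact lt_irrefl _ hxy
    · exact absurd (List.pairwise_iff_getElem.1 hs j i hj hi h) (not_le.2 hxy)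
  have hl : 1 < l.reverse.length := by simp; omega
  rw [List.getD_eq_getElem _ _ hl, List.getElem_reverse]
  rcases (show i ≤ l.length - 1 - 1 by omega).eq_or_lt with h | h
  · simp [← h]
  · exact List.pairwise_iff_getElem.1 hs _ _ _ _ h

theorem muMin_le_aux {W : Type*} [Fintype W] [DecidableEq W] (A : Matrix W W ℝ) (x : ℝ)
    (hx : x ∈ A.charpoly.roots) : muMin A ≤ x := by
  unfold muMin
  have hs : (A.charpoly.roots.sort (· ≤ ·)).Pairwise (· ≤ ·) := Multiset.pairwise_sort _ _
  rw [← Multiset.mem_sort (· ≤ ·)] at hx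
  generalize A.charpoly.roots.sort (· ≤ ·) = l at *
  obtain ⟨i, hi, rfl⟩ := List.mem_iff_getElem.1 hx
  rw [List.getD_eq_getElem _ _ (by omega)]
  rcases (Nat.zero_le i).eq_or_lt with h | h
  · simp [← h]
  · exact List.pairwise_iff_getElem.1 hs _ _ _ _ h

theorem lap_step {W : Type*} [Fintype W] [DecidableEq W]
    (G : SimpleGraph W) [DecidableRel G.Adj] (d : ℕ) (hW : 2 ≤ Fintype.card W) (hd : 1 ≤ d)
    (hreg : G.IsRegularOfDegree d)
    (hmu : |muMin (propMatrix G d)| ≤ mu2 (propMatrix G d)) (x : W → ℝ) :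
    ((propMatrix G d).mulVec x) ⬝ᵥ (G.lapMatrix ℝ).mulVec ((propMatrix G d).mulVec x)
      ≤ (mu2 (propMatrix G d)) ^ 2 * (x ⬝ᵥ (G.lapMatrix ℝ).mulVec x) := by
  have hd0 : (d : ℝ) ≠ 0 := by positivity
  have hdpos : (0 : ℝ) < d := by positivity
  set P := propMatrix G d with hP
  have hH : P.IsHermitian := by
    rw [hP, propMatrix, Matrix.IsHermitian, Matrix.conjTranspose_smul]
    simp
  have hlap : ∀ y : W → ℝ, (G.lapMatrix ℝ).mulVec y = (d : ℝ) • (y - P.mulVec y) := by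
    intro y
    ext v
    rw [SimpleGraph.lapMatrix_mulVec_apply, hreg v]
    simp only [hP, propMatrix, Matrix.smul_mulVec, Pi.smul_apply, Pi.sub_apply, smul_eq_mul,
      SimpleGraph.adjMatrix_mulVec_apply]
    field_simp
  set b : W → W → ℝ := fun j => ⇑(hH.eigenvectorBasis j) with hb
  set lam := hH.eigenvalues with hlam
  have hbP : ∀ j, P.mulVec (b j) = lam j • b j := fun j => hH.mulVec_eigenvectorBasis j
  have hin : ∀ y z : W → ℝ, y ⬝ᵥ z = ∑ j, (b j ⬝ᵥ y) * (b j ⬝ᵥ z) := by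
    intro y z
    have := hH.eigenvectorBasis.sum_inner_mul_inner (WithLp.toLp 2 y) (WithLp.toLp 2 z)
    simp only [EuclideanSpace.inner_eq_star_dotProduct, star_trivial] at this
    rw [dotProduct_comm, ← this]
    refine Finset.sum_congr rfl fun j _ => ?_
    rw [dotProduct_comm z]
  have hbP' : ∀ j y, b j ⬝ᵥ P.mulVec y = lam j * (b j ⬝ᵥ y) := by
    intro j y
    have hT : P.transpose = P := (Matrix.isHermitian_iff_isSymm.1 hH).eq
    rw [Matrix.dotProduct_mulVec, ← Matrix.mulVec_transpose, hT, hbP, smul_dotProduct, smul_eq_mul]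
  have hq : ∀ y : W → ℝ, y ⬝ᵥ (G.lapMatrix ℝ).mulVec y
      = d * ∑ j, (1 - lam j) * (b j ⬝ᵥ y) ^ 2 := by
    intro y
    rw [hlap, dotProduct_smul, smul_eq_mul, hin]
    congr 1
    refine Finset.sum_congr rfl fun j _ => ?_
    rw [dotProduct_sub, hbP']; ring
  have hbb : ∀ j, b j ⬝ᵥ b j = 1 := by
    intro j
    have := hH.eigenvectorBasis.orthonormal.1 j
    have h2 := real_inner_self_eq_norm_sq (hH.eigenvectorBasis j)
    rw [this, EuclideanSpace.inner_eq_star_dotProduct, star_trivial] at h2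
    simpa using h2
  have hle1 : ∀ j, lam j ≤ 1 := by
    intro j
    have h0 : 0 ≤ b j ⬝ᵥ (G.lapMatrix ℝ).mulVec (b j) := by
      rw [← Matrix.toLinearMap₂'_apply', SimpleGraph.lapMatrix_toLinearMap₂']
      positivity
    rw [hlap, dotProduct_smul, dotProduct_sub, hbP', hbb, smul_eq_mul] at h0
    have := nonneg_of_mul_nonneg_right h0 hdpos
    linarith
  have hmem : ∀ j, lam j ∈ P.charpoly.roots := by
    intro j
    rw [hH.roots_charpoly_eq_eigenvalues]
    exact Multiset.mem_map.2 ⟨j, by simp, rfl⟩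
  have hone : ∃ j, lam j = 1 := by
    by_contra hc
    push Not at hc
    have hP1 : (G.lapMatrix ℝ).mulVec (fun _ => (1 : ℝ)) = 0 := G.lapMatrix_mulVec_const_eq_zero
    rw [hlap, smul_eq_zero, or_iff_right hd0, sub_eq_zero] at hP1
    have hz : ∀ j, b j ⬝ᵥ (fun _ => (1 : ℝ)) = 0 := by
      intro j
      have := hbP' j (fun _ => 1)
      rw [← hP1] at this
      by_contra hne
      exact hc j (mul_right_cancel₀ hne (by linarith))
    have := hin (fun _ => 1) (fun _ => 1)
    simp only [hz] at this
    simp [dotProduct] at this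
    omega
  obtain ⟨j0, hj0⟩ := hone
  rw [hq, hq, mul_left_comm]
  refine mul_le_mul_of_nonneg_left ?_ hdpos.le
  rw [Finset.mul_sum]
  refine Finset.sum_le_sum fun j _ => ?_
  rw [hbP']
  rcases (hle1 j).eq_or_lt with h | h
  · simp [h]
  · have h1 := le_mu2_aux P (lam j) 1 (hmem j) (hj0 ▸ hmem j0) h
    have h2 := muMin_le_aux P (lam j) (hmem j)
    have h3 := (abs_le.1 hmu).1
    have h4 : lam j ^ 2 ≤ mu2 P ^ 2 := sq_le_sq' (by linarith) h1
    have h5 : 0 ≤ (1 - lam j) * (b j ⬝ᵥ x) ^ 2 := mul_nonneg (by linarith) (sq_nonneg _)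
    nlinarith [mul_le_mul_of_nonneg_right h4 h5]

/-- Dirichlet energy decay for a `d`-regular graph: if
`|μ_n| ≤ μ₂` then `ℰ(P^L X) ≤ μ₂^(2L) ℰ(X)` for all `L`. -/
theorem stmt7 {W : Type*} [Fintype W] [DecidableEq W]
    (G : SimpleGraph W) [DecidableRel G.Adj]
    (n d : ℕ) (hn : 2 ≤ n) (hcard : Fintype.card W = n) (hd : 1 ≤ d)
    (hreg : G.IsRegularOfDegree d)
    (hmu : |muMin (propMatrix G d)| ≤ mu2 (propMatrix G d))
    (k : ℕ) (X : Matrix W (Fin k) ℝ) :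
    ∀ L : ℕ, dirichletEnergy G ((propMatrix G d) ^ L * X) ≤
      (mu2 (propMatrix G d)) ^ (2 * L) * dirichletEnergy G X := by
  intro L
  induction L with
  | zero => simp
  | succ L ih =>
    have hstep : ∀ Y : Matrix W (Fin k) ℝ, dirichletEnergy G (propMatrix G d * Y) ≤
        (mu2 (propMatrix G d)) ^ 2 * dirichletEnergy G Y := by
      intro Y
      rw [energy_eq_lap, energy_eq_lap, Finset.mul_sum]
      refine Finset.sum_le_sum fun i _ => ?_
      exact lap_step G d (hcard ▸ hn) hd hreg hmu (fun u => Y u i)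
    rw [pow_succ', Matrix.mul_assoc]
    refine (hstep _).trans ?_
    refine (mul_le_mul_of_nonneg_left ih (sq_nonneg _)).trans_eq ?_
    ring
end
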